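/- Let (Ω,F,P) be a complete filtered probability space and let X = (X_t)_{t≥0} be an adapted supermartingale whose sample paths are right-continuous with left limits, such that X_0 = 0 almost surely and all jumps of X are nonnegative (for every ω and every t > 0, the left limit X_{t−}(ω) satisfies X_{t−}(ω) ≤ X_t(ω)). Let M_t(ω) = sup_{0≤s≤t} |X_s(ω)| and M⁻_t(ω) = inf_{0≤s≤t} min(X_s(ω), 0). Then for every 0 < p < 1 and every t ≥ 0, E[(M_t)^p] ≤ 𝔠_p^p · E[(−M⁻_t)^p], where 𝔠_p^p = (1/p − 1)^p + ∫_{1/p−1}^∞ s^{p−1}/(s+1) ds if 0 < p ≤ 1/2, and 𝔠_p^p = 1 + ∫_1^∞ s^{p−1}/(s+1) ds if 1/2 < p < 1. -/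

import Mathlib

open MeasureTheory Filter Set
open scoped NNReal

/-- The predictable integrand: `1 / (y + I)` (with `I` the running maximum of `-x`) until `x`
exceeds `y` or `I` reaches `b`, then `0`, and constant once `x` has dropped by more than `δ` in
one step. -/
noncomputable def holding (y b δ : ℝ) (x : ℕ → ℝ) : ℕ → ℝ
  | 0 => 1 / y
  | n + 1 =>
    if δ < partialSups (fun k => x (k - 1) - x k) (n + 1) then holding y b δ x n
    else if y < partialSups x (n + 1) ∨ b ≤ partialSups (fun k => -x k) (n + 1) then 0
    else 1 / (y + partialSups (fun k => -x k) (n + 1))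

lemma partialSups_nonneg_of_zero {u : ℕ → ℝ} (h : 0 ≤ u 0) (n : ℕ) : 0 ≤ partialSups u n :=
  h.trans (le_partialSups_of_le u (Nat.zero_le n))

lemma holding_mem {y b δ : ℝ} {x : ℕ → ℝ} (hy : 0 < y) (hx : x 0 = 0) (n : ℕ) :
    0 ≤ holding y b δ x n ∧ holding y b δ x n ≤ 1 / y := by
  induction n with
  | zero => simp [holding, hy.le]
  | succ n ih =>
    have hI := partialSups_nonneg_of_zero (u := fun k => -x k) (by simp [hx]) (n + 1)
    rw [holding]
    split_ifs
    · exact ih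
    · exact ⟨le_rfl, by positivity⟩
    · exact ⟨by positivity, one_div_le_one_div_of_le hy (by linarith)⟩

lemma holding_eq {y b δ : ℝ} {x : ℕ → ℝ} (hy : 0 < y) (hb : 0 < b) (hx : x 0 = 0) (n : ℕ)
    (hD : partialSups (fun k => x (k - 1) - x k) n ≤ δ) :
    holding y b δ x n = if y < partialSups x n ∨ b ≤ partialSups (fun k => -x k) n then 0
      else 1 / (y + partialSups (fun k => -x k) n) := by
  cases n with
  | zero => simp [holding, hx, hy.le, hb]
  | succ n => rw [holding, if_neg hD.not_gt]

lemma div_le_mul_log_sub {y δ i j : ℝ} (hy : 0 < y) (hi : 0 ≤ i) (hij : i ≤ j) (hj : j ≤ i + δ) :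
    (j - i) / (y + i) ≤ (1 + δ / y) * (Real.log (1 + j / y) - Real.log (1 + i / y)) := by
  have hδ : 0 ≤ δ := by linarith
  have e : ∀ u : ℝ, 1 + u / y = (y + u) / y := fun u => by field_simp
  have hyi : 0 < y + i := by linarith
  have hyj : 0 < y + j := by linarith
  rw [e i, e j, ← Real.log_div (by positivity) (by positivity)]
  have h1 := Real.one_sub_inv_le_log_of_pos (x := (y + j) / y / ((y + i) / y)) (by positivity)
  have h2 : 1 - ((y + j) / y / ((y + i) / y))⁻¹ = (j - i) / (y + j) := by field_simp; ring
  rw [h2] at h1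
  refine le_trans ?_ (mul_le_mul_of_nonneg_left h1 (by positivity))
  rw [show (j - i) / (y + i) = ((y + j) / (y + i)) * ((j - i) / (y + j)) by field_simp]
  refine mul_le_mul_of_nonneg_right ?_ (div_nonneg (by linarith) hyj.le)
  rw [e, div_le_div_iff₀ hyi hy]
  nlinarith

lemma gain_lower_bound {y b δ : ℝ} {x : ℕ → ℝ} (hy : 0 < y) (hb : 0 < b) (hδ : 0 < δ)
    (hx : x 0 = 0) (n : ℕ) :
    (partialSups (fun k => x (k - 1) - x k) n ≤ δ →
      (x n + partialSups (fun k => -x k) n) * holding y b δ x n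
        + (if y < partialSups x n ∧ partialSups (fun k => -x k) n < b then 1 else 0)
        - (1 + δ / y) * Real.log (1 + min (partialSups (fun k => -x k) n) (b + δ) / y)
      ≤ ∑ k ∈ Finset.range n, holding y b δ x k * (x (k + 1) - x k)) ∧
    (δ < partialSups (fun k => x (k - 1) - x k) n →
      x n * holding y b δ x n - (1 + δ / y) * Real.log (1 + (b + δ) / y)
      ≤ ∑ k ∈ Finset.range n, holding y b δ x k * (x (k + 1) - x k)) := by
  induction n with
  | zero =>
    refine ⟨fun _ => ?_, fun h => ?_⟩
    · simp [hx, min_eq_left (by linarith : (0 : ℝ) ≤ b + δ), hy.not_gt]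
    · simp [hx] at h; linarith
  | succ n ih =>
    rw [Finset.sum_range_succ]
    obtain ⟨hH0, hH1⟩ := holding_mem (b := b) (δ := δ) hy hx n
    have hI0 := partialSups_nonneg_of_zero (u := fun k => -x k) (by simp [hx]) n
    have hIn : -x n ≤ partialSups (fun k => -x k) n :=
      le_partialSups_of_le (fun k => -x k) le_rfl
    have hI : partialSups (fun k => -x k) (n + 1)
      = max (partialSups (fun k => -x k) n) (-x (n + 1)) := partialSups_add_one _ _
    have hS : partialSups x (n + 1) = max (partialSups x n) (x (n + 1)) := partialSups_add_one _ _
    have hD : partialSups (fun k => x (k - 1) - x k) (n + 1)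
      = max (partialSups (fun k => x (k - 1) - x k) n) (x n - x (n + 1)) := by
      exact partialSups_add_one _ _
    have hq : holding y b δ x (n + 1) =
      if δ < partialSups (fun k => x (k - 1) - x k) (n + 1) then holding y b δ x n
      else if y < partialSups x (n + 1) ∨ b ≤ partialSups (fun k => -x k) (n + 1) then 0
      else 1 / (y + partialSups (fun k => -x k) (n + 1)) := rfl
    have hq' := holding_eq (δ := δ) hy hb hx n
    generalize holding y b δ x n = H at *
    generalize holding y b δ x (n + 1) = H' at *
    generalize partialSups (fun k => -x k) n = I at *
    generalize partialSups (fun k => -x k) (n + 1) = I' at *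
    generalize partialSups x n = S at *
    generalize partialSups x (n + 1) = S' at *
    generalize partialSups (fun k => x (k - 1) - x k) n = D at *
    generalize partialSups (fun k => x (k - 1) - x k) (n + 1) = D' at *
    generalize ∑ k ∈ Finset.range n, holding y b δ x k * (x (k + 1) - x k) = G at *
    generalize x n = u at *
    generalize x (n + 1) = v at *
    have hmono : ∀ i j : ℝ, 0 ≤ i → i ≤ j → (1 + δ / y) * Real.log (1 + i / y)
        ≤ (1 + δ / y) * Real.log (1 + j / y) := fun i j hi hij => by gcongr
    have hII : I ≤ I' := hI ▸ le_max_left _ _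
    have hvI : -v ≤ I' := hI ▸ le_max_right _ _
    have hSS : S ≤ S' := hS ▸ le_max_left _ _
    constructor
    · intro hDD
      have hDn : D ≤ δ := (le_max_left _ _).trans (hD ▸ hDD)
      have hduv : u - v ≤ δ := (le_max_right _ _).trans (hD ▸ hDD)
      have hIδ : I' ≤ I + δ := by rw [hI]; exact max_le (by linarith) (by linarith)
      rw [if_neg hDD.not_gt] at hq
      have ih1 := ih.1 hDn
      have hq1 := hq' hDn
      by_cases hs : y < S ∨ b ≤ I
      · rw [if_pos hs] at hq1
        have hs' : y < S' ∨ b ≤ I' := hs.imp (fun h => h.trans_le hSS) (fun h => h.trans hII)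
        rw [if_pos hs'] at hq
        have he : (if y < S' ∧ I' < b then (1 : ℝ) else 0) ≤ if y < S ∧ I < b then 1 else 0 := by
          split_ifs with h1 h2
          · exact le_rfl
          · exfalso
            rcases hs with hs | hs
            · exact h2 ⟨hs, hII.trans_lt h1.2⟩
            · linarith [h1.2]
          · norm_num
          · exact le_rfl
        have := hmono (min I (b + δ)) (min I' (b + δ)) (le_min hI0 (by linarith))
          (min_le_min_right _ hII)
        subst hq1 hq
        linarith
      · rw [if_neg hs] at hq1
        push Not at hs
        rw [if_neg (by simp [hs.1])] at ih1
        rw [min_eq_left (by linarith)] at ih1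
        rw [min_eq_left (by linarith)]
        have hlog := div_le_mul_log_sub hy hI0 hII hIδ
        have hyI : 0 < y + I := by linarith
        have hsplit : (v + I) * H = (v + I') / (y + I) - (I' - I) / (y + I) := by
          rw [hq1]; field_simp; ring
        suffices h : (v + I') * H' + (if y < S' ∧ I' < b then 1 else 0) ≤ (v + I') / (y + I) by
          linarith
        have hvI' : 0 ≤ v + I' := by linarith
        by_cases hs' : y < S' ∨ b ≤ I'
        · rw [if_pos hs'] at hq
          rw [hq, mul_zero, zero_add]
          split_ifs with h1
          · have hv : y < v := by
              rcases lt_max_iff.1 (hS ▸ h1.1) with h | h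
              · linarith [hs.1]
              · exact h
            rw [le_div_iff₀ hyI]; linarith
          · positivity
        · rw [if_neg hs'] at hq
          rw [if_neg (fun h => hs' (Or.inl h.1)), add_zero, hq, ← div_eq_mul_one_div]
          gcongr
    · intro hDD
      rw [if_pos hDD] at hq
      rw [hq]
      rcases le_or_gt D δ with hDn | hDn
      · have ih1 := ih.1 hDn
        have := hmono (min I (b + δ)) (b + δ) (le_min hI0 (by linarith)) (min_le_right _ _)
        have he : (0 : ℝ) ≤ if y < S ∧ I < b then 1 else 0 := by split_ifs <;> norm_num
        nlinarith [mul_nonneg hI0 hH0]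
      · linarith [ih.2 hDn]

lemma indicator_sub_le_gain {y b δ : ℝ} {x : ℕ → ℝ} (hy : 0 < y) (hb : 0 < b) (hδ : 0 < δ)
    (hx : x 0 = 0) (n : ℕ) {J : ℝ} (hJ : ∀ k ≤ n, -x k ≤ J) :
    (if y < partialSups x n ∧ J < b ∧ partialSups (fun k => x (k - 1) - x k) n ≤ δ then 1 else 0)
      - (if partialSups (fun k => x (k - 1) - x k) n ≤ δ then 0 else
          |x n| / y + (1 + δ / y) * Real.log (1 + (b + δ) / y))
      - (1 + δ / y) * Real.log (1 + min J (b + δ) / y)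
      ≤ ∑ k ∈ Finset.range n, holding y b δ x k * (x (k + 1) - x k) := by
  obtain ⟨h1, h2⟩ := gain_lower_bound hy hb hδ hx n
  obtain ⟨hH0, hH1⟩ := holding_mem (b := b) (δ := δ) hy hx n
  have hI0 := partialSups_nonneg_of_zero (u := fun k => -x k) (by simp [hx]) n
  have hIn : -x n ≤ partialSups (fun k => -x k) n :=
      le_partialSups_of_le (fun k => -x k) le_rfl
  have hIJ : partialSups (fun k => -x k) n ≤ J := partialSups_le _ _ _ hJ
  have hJ0 : 0 ≤ J := hI0.trans hIJ
  have hmono : ∀ i j : ℝ, 0 ≤ i → i ≤ j → (1 + δ / y) * Real.log (1 + i / y)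
    ≤ (1 + δ / y) * Real.log (1 + j / y) := fun i j hi hij => by gcongr
  by_cases hD : partialSups (fun k => x (k - 1) - x k) n ≤ δ
  · refine le_trans ?_ (h1 hD)
    have := hmono _ _ (le_min hI0 (by linarith : 0 ≤ b + δ)) (min_le_min_right (b + δ) hIJ)
    have h3 : 0 ≤ (x n + partialSups (fun k => -x k) n) * holding y b δ x n :=
      mul_nonneg (by linarith) hH0
    have he : (if y < partialSups x n ∧ J < b ∧ partialSups (fun k => x (k - 1) - x k) n ≤ δ
        then (1 : ℝ) else 0)
        ≤ if y < partialSups x n ∧ partialSups (fun k => -x k) n < b then 1 else 0 := by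
      split_ifs with ha hb'
      · exact le_rfl
      · exact absurd ⟨ha.1, hIJ.trans_lt ha.2.1⟩ hb'
      · norm_num
      · exact le_rfl
    rw [if_pos hD]
    linarith
  · refine le_trans ?_ (h2 (not_le.1 hD))
    rw [if_neg hD, if_neg (fun h => hD h.2.2)]
    have := hmono 0 _ le_rfl (le_min hJ0 (by linarith : 0 ≤ b + δ))
    simp only [zero_div, add_zero, Real.log_one, mul_zero] at this
    have h4 : -(|x n| / y) ≤ x n * holding y b δ x n := by
      have h5 := neg_abs_le (x n * holding y b δ x n)
      rw [abs_mul, abs_of_nonneg hH0] at h5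
      have := mul_le_mul_of_nonneg_left hH1 (abs_nonneg (x n))
      rw [← div_eq_mul_one_div] at this
      linarith
    linarith

lemma tendsto_div_succ (t : ℝ≥0) :
    Tendsto (fun n : ℕ => ((t / (n + 1 : ℕ) : ℝ≥0) : ℝ)) atTop (nhds ((0 : ℝ≥0) : ℝ)) := by
  have := (tendsto_const_nhds (x := (t : ℝ))).div_atTop
    (tendsto_natCast_atTop_atTop.comp (tendsto_add_atTop_nat 1))
  simpa using this

lemma grid_mono (t : ℝ≥0) (N : ℕ) : Monotone fun k : ℕ => t * k / (N : ℝ≥0) := by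
  intro k l hkl
  dsimp only
  gcongr

lemma grid_le {t : ℝ≥0} {k N : ℕ} (h : k ≤ N) : t * k / (N : ℝ≥0) ≤ t := by
  rcases Nat.eq_zero_or_pos N with rfl | hN
  · simp
  · rw [div_le_iff₀ (by positivity)]
    gcongr

lemma exists_grid_gt {g : ℝ≥0 → ℝ} {s t : ℝ≥0} {y : ℝ} (hst : s ≤ t)
    (hg : ContinuousWithinAt g (Ici s) s) (hy : y < g s) :
    ∀ᶠ n : ℕ in atTop, ∃ k ≤ n + 1, y < g (t * k / (n + 1 : ℕ)) := by
  rcases hst.eq_or_lt with rfl | hst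
  · refine Eventually.of_forall fun n => ⟨n + 1, le_rfl, ?_⟩
    rwa [mul_div_assoc, div_self (by positivity), mul_one]
  have ht : 0 < t := pos_of_gt hst
  have h1 := hg.eventually_const_lt hy
  obtain ⟨u, hu, hsub⟩ := mem_nhdsGE_iff_exists_Ico_subset.1 h1
  rw [mem_Ioi] at hu
  have hlim : Tendsto (fun n : ℕ => s + t / (n + 1 : ℕ)) atTop (nhds s) := by
    simpa using (NNReal.tendsto_coe.1 (tendsto_div_succ t)).const_add s
  filter_upwards [hlim.eventually_lt_const hu] with n hn
  have hn0 : (0 : ℝ≥0) < (n + 1 : ℕ) := by positivity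
  have h2 := Nat.le_ceil (s * (n + 1 : ℕ) / t)
  have h3 := Nat.ceil_lt_add_one (a := s * (n + 1 : ℕ) / t) zero_le
  refine ⟨⌈s * (n + 1 : ℕ) / t⌉₊, Nat.ceil_le.2 ?_, hsub ⟨?_, lt_trans ?_ hn⟩⟩
  · rw [div_le_iff₀ ht, mul_comm]
    gcongr
  · rw [le_div_iff₀ hn0, mul_comm t]
    rwa [div_le_iff₀ ht] at h2
  · rw [div_lt_iff₀ hn0, add_mul, div_mul_cancel₀ _ hn0.ne', mul_comm t]
    rw [div_add_one ht.ne', lt_div_iff₀ ht] at h3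
    exact h3

lemma exists_nhds_sub_le {g : ℝ≥0 → ℝ} {w : ℝ≥0} {δ : ℝ} (hδ : 0 < δ)
    (hr : ContinuousWithinAt g (Ici w) w)
    (hl : 0 < w → ∃ l, Tendsto g (nhdsWithin w (Iio w)) (nhds l) ∧ l ≤ g w) :
    ∃ V ∈ nhds w, BddAbove ((fun s => |g s|) '' V) ∧
      ∀ u ∈ V, ∀ v ∈ V, u ≤ v → g u - g v ≤ δ := by
  have hδ2 : 0 < δ / 2 := half_pos hδ
  have hR := Metric.tendsto_nhds.1 hr (δ / 2) hδ2
  obtain ⟨l, hL, hlw⟩ : ∃ l, (∀ᶠ s in nhdsWithin w (Iio w), dist (g s) l < δ / 2) ∧ l ≤ g w := by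
    rcases eq_or_ne w 0 with rfl | hw
    · exact ⟨g 0, by
        rw [show Iio (0 : ℝ≥0) = ∅ from Set.eq_empty_of_forall_notMem fun _ h => not_lt_zero (mem_Iio.1 h)]
        simp, le_rfl⟩
    · obtain ⟨l, h, h'⟩ := hl (pos_iff_ne_zero.2 hw)
      exact ⟨l, Metric.tendsto_nhds.1 h _ hδ2, h'⟩
  rw [eventually_nhdsWithin_iff] at hR hL
  refine ⟨_, hR.and hL, ⟨|g w| + |l| + δ / 2, ?_⟩, ?_⟩
  · rintro _ ⟨s, ⟨h1, h2⟩, rfl⟩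
    simp only [Real.dist_eq, abs_lt] at h1 h2
    rcases lt_or_ge s w with h | h
    · have := h2 h
      rw [abs_le]
      constructor <;> linarith [neg_abs_le l, le_abs_self l, abs_nonneg (g w)]
    · have := h1 h
      rw [abs_le]
      constructor <;> linarith [neg_abs_le (g w), le_abs_self (g w), abs_nonneg l]
  · rintro u ⟨hu1, hu2⟩ v ⟨hv1, hv2⟩ huv
    simp only [Real.dist_eq, abs_lt] at hu1 hu2 hv1 hv2
    rcases lt_or_ge u w with hu | hu
    · have := hu2 hu
      rcases lt_or_ge v w with hv | hv
      · linarith [hv2 hv]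
      · linarith [hv1 hv]
    · linarith [hu1 hu, hv1 (hu.trans huv)]

/-- A right-continuous path on `ℝ≥0` with left limits and no negative jump. -/
def IsCadlagUp (g : ℝ≥0 → ℝ) : Prop :=
  ∀ w, ContinuousWithinAt g (Ici w) w ∧
    (0 < w → ∃ l, Tendsto g (nhdsWithin w (Iio w)) (nhds l) ∧ l ≤ g w)

lemma IsCadlagUp.bddAbove {g : ℝ≥0 → ℝ} (hg : IsCadlagUp g) (t : ℝ≥0) :
    BddAbove ((fun s => |g s|) '' Icc 0 t) := by
  refine isCompact_Icc.induction_on (p := fun s => BddAbove ((fun s => |g s|) '' s))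
    (by simp) (fun s u hsu hu => hu.mono (image_mono hsu))
    (fun s u hs hu => by rw [image_union]; exact hs.union hu) (fun w _ => ?_)
  obtain ⟨V, hV, hb, -⟩ := exists_nhds_sub_le one_pos (hg w).1 (hg w).2
  exact ⟨V, mem_nhdsWithin_of_mem_nhds hV, hb⟩

lemma IsCadlagUp.exists_sub_le {g : ℝ≥0 → ℝ} (hg : IsCadlagUp g) (t : ℝ≥0) {δ : ℝ} (hδ : 0 < δ) :
    ∃ η > 0, ∀ u ≤ t, ∀ v, u ≤ v → dist v u < η → g u - g v ≤ δ := by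
  choose V hV _ hsub using fun w => exists_nhds_sub_le hδ (hg w).1 (hg w).2
  obtain ⟨η, hη, h⟩ := lebesgue_number_lemma_of_metric (isCompact_Icc (a := 0) (b := t))
    (c := fun w => interior (V w)) (fun _ => isOpen_interior)
    (fun w _ => mem_iUnion.2 ⟨w, mem_interior_iff_mem_nhds.2 (hV w)⟩)
  refine ⟨η, hη, fun u hu v huv hd => ?_⟩
  obtain ⟨w, hw⟩ := h u ⟨zero_le, hu⟩
  exact hsub w u (interior_subset (hw (Metric.mem_ball_self hη))) v (interior_subset (hw hd)) huv

lemma IsCadlagUp.eventually_grid_sub_le {g : ℝ≥0 → ℝ} (hg : IsCadlagUp g) (t : ℝ≥0) {δ : ℝ}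
    (hδ : 0 < δ) :
    ∀ᶠ n : ℕ in atTop, ∀ k ≤ n, g (t * k / (n + 1 : ℕ)) - g (t * (k + 1 : ℕ) / (n + 1 : ℕ)) ≤ δ := by
  obtain ⟨η, hη, h⟩ := hg.exists_sub_le t hδ
  filter_upwards [(tendsto_div_succ t).eventually_lt_const (by simpa using hη)] with n hn k hk
  have hn0 : (0 : ℝ≥0) < (n + 1 : ℕ) := by positivity
  refine h _ (grid_le (by omega)) _ (grid_mono t (n + 1) (Nat.le_succ k)) (lt_of_eq_of_lt ?_ hn)
  rw [NNReal.dist_eq]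
  push_cast
  rw [show (t : ℝ) * (k + 1) / (n + 1) - t * k / (n + 1) = t / (n + 1) by ring]
  exact abs_of_nonneg (by positivity)

lemma lt_iSup_Icc_iff {h : ℝ≥0 → ℝ} {t : ℝ≥0} (hb : BddAbove (h '' Icc 0 t)) {y : ℝ} :
    (y < ⨆ s : Icc (0 : ℝ≥0) t, h s.1) ↔ ∃ s ≤ t, y < h s := by
  have : Nonempty (Icc (0 : ℝ≥0) t) := ⟨⟨0, le_rfl, zero_le⟩⟩
  rw [lt_ciSup_iff (by rwa [image_eq_range] at hb)]
  exact ⟨fun ⟨s, hs⟩ => ⟨s.1, s.2.2, hs⟩, fun ⟨s, hst, hs⟩ => ⟨⟨s, zero_le, hst⟩, hs⟩⟩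

lemma measurable_iSup_Icc {Ω : Type*} {m0 : MeasurableSpace Ω} {h : ℝ≥0 → Ω → ℝ} {t : ℝ≥0}
    (hm : ∀ s, Measurable (h s)) (hb : ∀ ω, BddAbove ((fun s => h s ω) '' Icc 0 t))
    (hrc : ∀ ω s, ContinuousWithinAt (fun s => h s ω) (Ici s) s) :
    Measurable fun ω => ⨆ s : Icc (0 : ℝ≥0) t, h s.1 ω := by
  refine measurable_of_Ioi fun y => ?_
  have : (fun ω => ⨆ s : Icc (0 : ℝ≥0) t, h s.1 ω) ⁻¹' Ioi y
      = ⋃ n : ℕ, ⋃ k : ℕ, ⋃ _ : k ≤ n + 1, {ω | y < h (t * k / (n + 1 : ℕ)) ω} := by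
    ext ω
    simp only [mem_preimage, mem_Ioi, mem_iUnion, mem_ofPred_eq, exists_prop]
    rw [lt_iSup_Icc_iff (hb ω)]
    constructor
    · rintro ⟨s, hst, hs⟩
      exact (exists_grid_gt hst (hrc ω s) hs).exists
    · rintro ⟨n, k, hk, hy⟩
      exact ⟨_, grid_le hk, hy⟩
  rw [this]
  exact .iUnion fun n => .iUnion fun k => .iUnion fun _ => measurableSet_lt measurable_const (hm _)

lemma neg_iInf_eq_iSup {ι : Type*} (f : ι → ℝ) : -(⨅ i, f i) = ⨆ i, -f i := by
  rw [iInf, Real.sInf_def, neg_neg, iSup]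
  congr 1
  ext x
  simp [neg_eq_iff_eq_neg]

lemma IsCadlagUp.bddAbove_neg_min {g : ℝ≥0 → ℝ} (hg : IsCadlagUp g) (t : ℝ≥0) :
    BddAbove ((fun s => -min (g s) 0) '' Icc 0 t) := by
  obtain ⟨C, hC⟩ := hg.bddAbove t
  refine ⟨C, ?_⟩
  rintro _ ⟨s, hs, rfl⟩
  refine le_trans ?_ (hC ⟨s, hs, rfl⟩)
  dsimp only
  rw [neg_le, le_min_iff]
  exact ⟨neg_abs_le _, by simp⟩

lemma IsCadlagUp.lt_neg_iInf_iff {g : ℝ≥0 → ℝ} (hg : IsCadlagUp g) {t : ℝ≥0} {y : ℝ} (hy : 0 ≤ y) :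
    (y < -(⨅ s : Icc (0 : ℝ≥0) t, min (g s.1) 0)) ↔ ∃ s ≤ t, y < -g s := by
  rw [neg_iInf_eq_iSup, lt_iSup_Icc_iff (h := fun s => -min (g s) 0) (hg.bddAbove_neg_min t)]
  refine exists_congr fun s => and_congr_right fun _ => ?_
  rw [lt_neg, min_lt_iff, lt_neg]
  exact or_iff_left (by linarith)

lemma neg_iInf_min_nonneg (g : ℝ≥0 → ℝ) (t : ℝ≥0) :
    0 ≤ -(⨅ s : Icc (0 : ℝ≥0) t, min (g s.1) 0) := by
  rw [neg_iInf_eq_iSup]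
  exact Real.iSup_nonneg fun s => by simp

lemma IsCadlagUp.neg_le_neg_iInf {g : ℝ≥0 → ℝ} (hg : IsCadlagUp g) {s t : ℝ≥0} (hst : s ≤ t) :
    -g s ≤ -(⨅ s : Icc (0 : ℝ≥0) t, min (g s.1) 0) := by
  by_contra! h
  exact lt_irrefl _ ((hg.lt_neg_iInf_iff (neg_iInf_min_nonneg g t)).2 ⟨s, hst, h⟩)

lemma measurable_partialSups_apply {Ω : Type*} {m : MeasurableSpace Ω} {u : ℕ → Ω → ℝ} {n : ℕ}
    (h : ∀ k ≤ n, Measurable (u k)) : Measurable fun ω => partialSups (fun k => u k ω) n := by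
  induction n with
  | zero => simpa using h 0 le_rfl
  | succ n ih =>
    simp only [partialSups_add_one]
    exact (ih fun k hk => h k (by omega)).max (h _ le_rfl)

lemma measurable_holding {Ω : Type*} {m0 : MeasurableSpace Ω} {𝒢 : Filtration ℕ m0}
    {Y : ℕ → Ω → ℝ} (hY : StronglyAdapted 𝒢 Y) (y b δ : ℝ) (n : ℕ) :
    Measurable[𝒢 n] fun ω => holding y b δ (fun k => Y k ω) n := by
  induction n with
  | zero => exact measurable_const
  | succ n ih =>
    have hm : ∀ k ≤ n + 1, Measurable[𝒢 (n + 1)] (Y k) := fun k hk =>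
      (hY k).measurable.mono (𝒢.mono hk) le_rfl
    have hI := measurable_partialSups_apply (m := 𝒢 (n + 1)) (u := fun k => -Y k)
      fun k hk => (hm k hk).neg
    have hS := measurable_partialSups_apply (m := 𝒢 (n + 1)) (u := Y) hm
    have hD := measurable_partialSups_apply (m := 𝒢 (n + 1)) (u := fun k => Y (k - 1) - Y k)
      fun k hk => (hm (k - 1) (by omega)).sub (hm k hk)
    refine Measurable.ite (measurableSet_lt measurable_const hD)
      (ih.mono (𝒢.mono n.le_succ) le_rfl) (Measurable.ite ?_ measurable_const ?_)
    · exact (measurableSet_lt measurable_const hS).union (measurableSet_le measurable_const hI)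
    · exact (hI.const_add y).const_div 1

lemma integral_gain_nonpos {Ω : Type*} {m0 : MeasurableSpace Ω} {P : Measure Ω}
    [IsProbabilityMeasure P] {𝒢 : Filtration ℕ m0} {Y : ℕ → Ω → ℝ} (hY : Supermartingale Y 𝒢 P)
    (hY0 : ∀ ω, Y 0 ω = 0) {y : ℝ} (hy : 0 < y) (b δ : ℝ) (n : ℕ) :
    Integrable (fun ω => ∑ k ∈ Finset.range n,
      holding y b δ (fun k => Y k ω) k * (Y (k + 1) ω - Y k ω)) P ∧
    ∫ ω, ∑ k ∈ Finset.range n,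
      holding y b δ (fun k => Y k ω) k * (Y (k + 1) ω - Y k ω) ∂P ≤ 0 := by
  have h := hY.neg.sum_mul_sub (ξ := fun k ω => holding y b δ (fun k => Y k ω) k) (R := 1 / y)
    (fun k => (measurable_holding hY.1 y b δ k).stronglyMeasurable)
    (fun k ω => (holding_mem hy (hY0 ω) k).2) (fun k ω => (holding_mem hy (hY0 ω) k).1)
  have e : (fun ω => ∑ k ∈ Finset.range n,
      holding y b δ (fun k => Y k ω) k * (Y (k + 1) ω - Y k ω))
      = fun ω => -(∑ k ∈ Finset.range n, (fun ω => holding y b δ (fun k => Y k ω) k)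
        * ((-Y) (k + 1) - (-Y) k)) ω := by
    ext ω
    simp only [Finset.sum_apply, Pi.mul_apply, Pi.sub_apply, Pi.neg_apply,
      ← Finset.sum_neg_distrib]
    exact Finset.sum_congr rfl fun k _ => by ring
  have h0 := h.setIntegral_le (Nat.zero_le n) MeasurableSet.univ
  simp only [Finset.range_zero, Finset.sum_empty, Pi.zero_apply, integral_zero,
    setIntegral_univ] at h0
  refine ⟨?_, ?_⟩
  · rw [e]; exact (h.2.2 n).neg
  · rw [e, integral_neg]; linarith

lemma measureReal_lt_sup_le {Ω : Type*} {m0 : MeasurableSpace Ω} {P : Measure Ω}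
    [IsProbabilityMeasure P] {ℱ : Filtration ℝ≥0 m0} {X : ℝ≥0 → Ω → ℝ}
    (hX : Supermartingale X ℱ P) (hX0 : ∀ ω, X 0 ω = 0) (hc : ∀ ω, IsCadlagUp fun s => X s ω)
    (t : ℝ≥0) {J : Ω → ℝ} (hJm : Measurable J) (hJ : ∀ ω, ∀ s ≤ t, -X s ω ≤ J ω)
    {y b δ : ℝ} (hy : 0 < y) (hb : 0 < b) (hδ : 0 < δ) :
    P.real {ω | (∃ s ≤ t, y < X s ω) ∧ J ω < b}
      ≤ ∫ ω, (1 + δ / y) * Real.log (1 + min (J ω) (b + δ) / y) ∂P := by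
  classical
  let Y : ℕ → ℕ → Ω → ℝ := fun n k => X (t * k / (n + 1 : ℕ))
  let D : ℕ → Ω → ℝ := fun n ω => partialSups (fun k => Y n (k - 1) ω - Y n k ω) (n + 1)
  let C : ℝ := (1 + δ / y) * Real.log (1 + (b + δ) / y)
  let Z : ℕ → Ω → ℝ := fun n ω =>
    (if y < partialSups (fun k => Y n k ω) (n + 1) ∧ J ω < b ∧ D n ω ≤ δ then 1 else 0)
      - (if D n ω ≤ δ then 0 else |X t ω| / y + C)
  have hC : 0 ≤ C := mul_nonneg (by positivity) (Real.log_nonneg (by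
    have : 0 ≤ (b + δ) / y := by positivity
    linarith))
  have hXm : ∀ s, Measurable (X s) := fun s => (hX.1 s).measurable.mono (ℱ.le s) le_rfl
  have hJ0 : ∀ ω, 0 ≤ J ω := fun ω => by simpa [hX0] using hJ ω 0 zero_le
  have hSm : ∀ n, Measurable fun ω => partialSups (fun k => Y n k ω) (n + 1) := fun n =>
    measurable_partialSups_apply fun k _ => hXm _
  have hDm : ∀ n, Measurable (D n) := fun n =>
    measurable_partialSups_apply (u := fun k ω => Y n (k - 1) ω - Y n k ω)
      fun k _ => (hXm _).sub (hXm _)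
  have hZm : ∀ n, Measurable (Z n) := fun n => by
    refine (Measurable.ite ?_ measurable_const measurable_const).sub
      (Measurable.ite (measurableSet_le (hDm n) measurable_const) measurable_const
        (((continuous_abs.measurable.comp (hXm t)).div_const y).add_const C))
    exact (measurableSet_lt measurable_const (hSm n)).inter
      ((measurableSet_lt hJm measurable_const).inter (measurableSet_le (hDm n) measurable_const))
  have hXt : Integrable (fun ω => 1 + (|X t ω| / y + C)) P :=
    (integrable_const _).add (((hX.2.2 t).abs.div_const y).add (integrable_const _))
  have hZb : ∀ n ω, ‖Z n ω‖ ≤ 1 + (|X t ω| / y + C) := fun n ω => by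
    have : 0 ≤ |X t ω| / y := by positivity
    simp only [Z, Real.norm_eq_abs, abs_le]
    split_ifs <;> constructor <;> linarith
  have hΦm : Measurable fun ω => (1 + δ / y) * Real.log (1 + min (J ω) (b + δ) / y) := by
    fun_prop
  have hΦ : Integrable (fun ω => (1 + δ / y) * Real.log (1 + min (J ω) (b + δ) / y)) P := by
    refine Integrable.of_bound hΦm.aestronglyMeasurable C (Eventually.of_forall fun ω => ?_)
    have h0 : 0 ≤ min (J ω) (b + δ) := le_min (hJ0 ω) (by linarith)
    have h1 : 0 ≤ min (J ω) (b + δ) / y := by positivity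
    rw [Real.norm_of_nonneg (mul_nonneg (by positivity) (Real.log_nonneg (by linarith)))]
    simp only [C]
    gcongr
    exact min_le_right _ _
  have hZΦ : ∀ n, ∫ ω, Z n ω ∂P ≤ ∫ ω, (1 + δ / y) * Real.log (1 + min (J ω) (b + δ) / y) ∂P := by
    intro n
    let 𝒢 : Filtration ℕ m0 :=
      { seq := fun k => ℱ (t * k / (n + 1 : ℕ))
        mono' := fun i j hij => ℱ.mono (grid_mono t (n + 1) hij)
        le' := fun i => ℱ.le _ }
    have hY : Supermartingale (Y n) 𝒢 P :=
      ⟨fun k => hX.1 _, fun i j hij => hX.2.1 _ _ (grid_mono t (n + 1) hij), fun k => hX.2.2 _⟩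
    have hY0 : ∀ ω, Y n 0 ω = 0 := fun ω => by simp [Y, hX0]
    obtain ⟨hi, hle⟩ := integral_gain_nonpos hY hY0 hy b δ (n + 1)
    have hZi : Integrable (Z n) P := hXt.mono' (hZm n).aestronglyMeasurable
      (Eventually.of_forall (hZb n))
    rw [← sub_nonpos, ← integral_sub hZi hΦ]
    refine le_trans (integral_mono (hZi.sub hΦ) hi fun ω => ?_) hle
    have h := indicator_sub_le_gain hy hb hδ (hY0 ω) (n + 1)
      (fun k hk => hJ ω _ (grid_le hk))
    have ht : X (t * (n + 1 : ℕ) / (n + 1 : ℕ)) ω = X t ω := by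
      have : ((n + 1 : ℕ) : ℝ≥0) ≠ 0 := by positivity
      rw [mul_div_assoc, div_self this, mul_one]
    rw [ht] at h
    exact h
  have hmeas : MeasurableSet {ω | (∃ s ≤ t, y < X s ω) ∧ J ω < b} := by
    have hXb : ∀ ω, BddAbove ((fun s => X s ω) '' Icc 0 t) := fun ω => by
      obtain ⟨B, hB⟩ := (hc ω).bddAbove t
      exact ⟨B, by rintro _ ⟨s, hs, rfl⟩; exact (le_abs_self _).trans (hB ⟨s, hs, rfl⟩)⟩
    have hm := measurable_iSup_Icc hXm hXb fun ω s => (hc ω s).1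
    simp only [← lt_iSup_Icc_iff (hXb _)]
    exact (measurableSet_lt measurable_const hm).inter (measurableSet_lt hJm measurable_const)
  have hlim := tendsto_integral_of_dominated_convergence (μ := P) (F := Z)
    (f := {ω | (∃ s ≤ t, y < X s ω) ∧ J ω < b}.indicator 1) _
    (fun n => (hZm n).aestronglyMeasurable) hXt (fun n => Eventually.of_forall (hZb n))
    (Eventually.of_forall fun ω => by
      have hDδ : ∀ᶠ n in atTop, D n ω ≤ δ := by
        filter_upwards [(hc ω).eventually_grid_sub_le t hδ] with n hn
        refine partialSups_le _ _ _ fun k hk => ?_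
        rcases k with _ | k
        · simpa using hδ.le
        · exact hn k (by omega)
      refine tendsto_const_nhds.congr' ?_
      by_cases h : (∃ s ≤ t, y < X s ω) ∧ J ω < b
      · rw [indicator_of_mem (by exact h)]
        obtain ⟨⟨s, hst, hs⟩, hJb⟩ := h
        filter_upwards [hDδ, exists_grid_gt hst (hc ω s).1 hs] with n hD ⟨k, hk, hyk⟩
        have : y < partialSups (fun k => Y n k ω) (n + 1) :=
          hyk.trans_le (le_partialSups_of_le (fun k => Y n k ω) hk)
        simp only [Z]
        rw [if_pos ⟨this, hJb, hD⟩, if_pos hD, sub_zero, Pi.one_apply]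
      · rw [indicator_of_notMem (by exact h)]
        filter_upwards [hDδ] with n hD
        have : ¬ (y < partialSups (fun k => Y n k ω) (n + 1) ∧ J ω < b) := by
          rintro ⟨h1, h2⟩
          refine h ⟨?_, h2⟩
          by_contra! hcon
          exact h1.not_ge (partialSups_le _ _ _ fun k hk => hcon _ (grid_le hk))
        rw [not_and] at this
        simp only [Z, hD, and_true, if_true, sub_zero]
        rw [if_neg (fun h => this h.1 h.2)])
  rw [integral_indicator_one hmeas] at hlim
  exact le_of_tendsto' hlim hZΦ

lemma integral_one_div_add {y f : ℝ} (hy : 0 < y) (hf : 0 ≤ f) :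
    ∫ u in (0 : ℝ)..f, 1 / (y + u) = Real.log (1 + f / y) := by
  have h := intervalIntegral.integral_comp_add_left (a := 0) (b := f) (fun x : ℝ => x⁻¹) y
  simp only [one_div]
  rw [h, integral_inv_of_pos (by linarith) (by linarith), add_zero, add_div, div_self hy.ne']

lemma measure_lt_sup_le {Ω : Type*} {m0 : MeasurableSpace Ω} {P : Measure Ω}
    [IsProbabilityMeasure P] {ℱ : Filtration ℝ≥0 m0} {X : ℝ≥0 → Ω → ℝ}
    (hX : Supermartingale X ℱ P) (hX0 : ∀ ω, X 0 ω = 0) (hc : ∀ ω, IsCadlagUp fun s => X s ω)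
    (t : ℝ≥0) {J : Ω → ℝ} (hJm : Measurable J) (hJ : ∀ ω, ∀ s ≤ t, -X s ω ≤ J ω)
    {y b : ℝ} (hy : 0 < y) (hb : 0 < b) :
    P {ω | (∃ s ≤ t, y < X s ω) ∧ J ω < b}
      ≤ ∫⁻ u in Ioi 0, P {ω | u < min (J ω) b} * ENNReal.ofReal (1 / (y + u)) := by
  have hJ0 : ∀ ω, 0 ≤ J ω := fun ω => by simpa [hX0] using hJ ω 0 zero_le
  have hmin : ∀ ω, ∀ c : ℝ, 0 < c → 0 ≤ min (J ω) c / y := fun ω c hc =>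
    div_nonneg (le_min (hJ0 ω) hc.le) hy.le
  have hlim : Tendsto (fun δ : ℝ => ∫ ω, (1 + δ / y) * Real.log (1 + min (J ω) (b + δ) / y) ∂P)
      (nhdsWithin 0 (Ioi 0)) (nhds (∫ ω, Real.log (1 + min (J ω) b / y) ∂P)) := by
    refine tendsto_integral_filter_of_dominated_convergence
      (fun _ => (1 + 1 / y) * Real.log (1 + (b + 1) / y)) ?_ ?_ (integrable_const _) ?_
    · exact Eventually.of_forall fun δ =>
        (by fun_prop : Measurable _).aestronglyMeasurable
    · filter_upwards [Ioo_mem_nhdsGT one_pos] with δ hδ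
      refine Eventually.of_forall fun ω => ?_
      have h1 := hmin ω (b + δ) (by linarith [hδ.1])
      have hδ0 := hδ.1
      rw [Real.norm_of_nonneg (mul_nonneg (by positivity) (Real.log_nonneg (by linarith)))]
      have h2 : min (J ω) (b + δ) ≤ b + 1 := (min_le_right _ _).trans (by linarith [hδ.2])
      have h3 := hδ.2.le
      have h4 := Real.log_nonneg (by linarith : 1 ≤ 1 + min (J ω) (b + δ) / y)
      gcongr
    · refine Eventually.of_forall fun ω => tendsto_nhdsWithin_of_tendsto_nhds ?_
      have h1 := hmin ω b hb
      have : ContinuousAt (fun δ : ℝ => (1 + δ / y) * Real.log (1 + min (J ω) (b + δ) / y)) 0 := by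
        refine ContinuousAt.mul (by fun_prop) (ContinuousAt.log (by fun_prop) ?_)
        rw [add_zero]
        positivity
      simpa [ContinuousAt] using this
  have hle : P.real {ω | (∃ s ≤ t, y < X s ω) ∧ J ω < b}
      ≤ ∫ ω, Real.log (1 + min (J ω) b / y) ∂P := by
    refine ge_of_tendsto hlim ?_
    filter_upwards [self_mem_nhdsWithin] with δ hδ
    exact measureReal_lt_sup_le hX hX0 hc t hJm hJ hy hb hδ
  have hcomp := lintegral_comp_eq_lintegral_meas_lt_mul (f := fun ω => min (J ω) b)
    (g := fun u => 1 / (y + u)) P (Eventually.of_forall fun ω => le_min (hJ0 ω) hb.le)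
    (hJm.min measurable_const).aemeasurable
    (fun u hu => ContinuousOn.intervalIntegrable (by
      rw [uIcc_of_le hu.le]
      exact continuousOn_const.div (by fun_prop) fun x hx => by linarith [hx.1]))
    (by
      filter_upwards [ae_restrict_mem measurableSet_Ioi] with u hu
      have : (0 : ℝ) < u := hu
      positivity)
  rw [← hcomp, ← ENNReal.ofReal_toReal (measure_ne_top P _)]
  refine (ENNReal.ofReal_le_ofReal hle).trans (le_of_eq ?_)
  simp only [integral_one_div_add hy (le_min (hJ0 _) hb.le)]
  refine ofReal_integral_eq_lintegral_ofReal ?_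
    (Eventually.of_forall fun ω => Real.log_nonneg (by linarith [hmin ω b hb]))
  refine Integrable.of_bound (C := Real.log (1 + b / y))
    (by fun_prop : Measurable _).aestronglyMeasurable (Eventually.of_forall fun ω => ?_)
  have h1 := hmin ω b hb
  rw [Real.norm_of_nonneg (Real.log_nonneg (by linarith))]
  gcongr
  exact min_le_right _ _

lemma lintegral_Ioi_mul_left {u : ℝ} (hu : 0 < u) (a : ℝ) (f : ℝ → ENNReal) :
    ∫⁻ y in Ioi (a * u), f y = ∫⁻ s in Ioi a, ENNReal.ofReal u * f (u * s) := by
  have h := lintegral_image_eq_lintegral_abs_deriv_mul (s := Ioi a) (f := fun s => u * s)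
    (f' := fun _ => u) measurableSet_Ioi
    (fun x _ => by simpa using ((hasDerivAt_id x).const_mul u).hasDerivWithinAt)
    (fun x _ z _ h => mul_left_cancel₀ hu.ne' h) f
  rw [image_mul_left_Ioi hu, mul_comm] at h
  rw [h, abs_of_pos hu]

lemma lintegral_rpow_div_add {p a u : ℝ} (ha : 0 < a) (hu : 0 < u) :
    ∫⁻ y in Ioi (a * u), ENNReal.ofReal (1 / (y + u)) * ENNReal.ofReal (y ^ (p - 1))
      = ENNReal.ofReal (u ^ (p - 1)) * ∫⁻ s in Ioi a, ENNReal.ofReal (s ^ (p - 1) / (s + 1)) := by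
  rw [lintegral_Ioi_mul_left hu, ← lintegral_const_mul' _ _ ENNReal.ofReal_ne_top]
  refine setLIntegral_congr_fun measurableSet_Ioi fun s hs => ?_
  have hs0 : 0 < s := ha.trans hs
  have h1 : 0 ≤ 1 / (u * s + u) := by positivity
  rw [← ENNReal.ofReal_mul h1, ← ENNReal.ofReal_mul hu.le,
    ← ENNReal.ofReal_mul (by positivity), Real.mul_rpow hu.le hs0.le]
  congr 1
  field_simp

lemma lintegral_sup_rpow_le {Ω : Type*} {m0 : MeasurableSpace Ω} {P : Measure Ω}
    [IsProbabilityMeasure P] {ℱ : Filtration ℝ≥0 m0} {X : ℝ≥0 → Ω → ℝ}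
    (hX : Supermartingale X ℱ P) (hX0 : ∀ ω, X 0 ω = 0) (hc : ∀ ω, IsCadlagUp fun s => X s ω)
    (t : ℝ≥0) {M J : Ω → ℝ} (hMm : Measurable M) (hM0 : ∀ ω, 0 ≤ M ω)
    (hM : ∀ ω y, y < M ω → ∃ s ≤ t, y < |X s ω|)
    (hJm : Measurable J) (hJ : ∀ ω, ∀ s ≤ t, -X s ω ≤ J ω)
    {p a : ℝ} (hp : 0 < p) (ha : 1 ≤ a) :
    ∫⁻ ω, ENNReal.ofReal (M ω ^ p) ∂P
      ≤ (ENNReal.ofReal (a ^ p) + ∫⁻ s in Ioi a, ENNReal.ofReal (s ^ (p - 1) / (s + 1)))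
        * ∫⁻ ω, ENNReal.ofReal (J ω ^ p) ∂P := by
  have ha0 : 0 < a := by linarith
  have hJ0 : ∀ ω, 0 ≤ J ω := fun ω => by simpa [hX0] using hJ ω 0 zero_le
  have hbound : ∀ y : ℝ, 0 < y → P {ω | y < M ω} ≤ P {ω | y ≤ a * J ω} +
      ∫⁻ u in Ioi 0, P {ω | u < min (J ω) (y / a)} * ENNReal.ofReal (1 / (y + u)) := by
    intro y hy
    refine le_trans (measure_mono (t := {ω | y ≤ a * J ω} ∪
      {ω | (∃ s ≤ t, y < X s ω) ∧ J ω < y / a}) fun ω hω => ?_) ((measure_union_le _ _).trans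
        (add_le_add le_rfl (measure_lt_sup_le hX hX0 hc t hJm hJ hy (div_pos hy ha0))))
    by_cases h : y ≤ a * J ω
    · exact Or.inl h
    · push Not at h
      obtain ⟨s, hst, hs⟩ := hM ω y hω
      refine Or.inr ⟨⟨s, hst, ?_⟩, by rwa [lt_div_iff₀ ha0, mul_comm]⟩
      rcases lt_abs.1 hs with h' | h'
      · exact h'
      · nlinarith [hJ ω s hst, hJ0 ω]
  have hNm : Measurable fun u => P {ω | u < J ω} :=
    Antitone.measurable fun u v huv => measure_mono fun ω (hω : v < J ω) => huv.trans_lt hω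
  have hAm : Measurable fun y => P {ω | y ≤ a * J ω} :=
    Antitone.measurable fun u v huv => measure_mono fun ω (hω : v ≤ a * J ω) => huv.trans hω
  have hqm : Measurable fun y : ℝ => ENNReal.ofReal (y ^ (p - 1)) := by fun_prop
  have hAq : Measurable fun y => P {ω | y ≤ a * J ω} * ENNReal.ofReal (y ^ (p - 1)) := hAm.mul hqm
  have hA : ENNReal.ofReal p *
      ∫⁻ y in Ioi 0, P {ω | y ≤ a * J ω} * ENNReal.ofReal (y ^ (p - 1))
      = ENNReal.ofReal (a ^ p) * ∫⁻ ω, ENNReal.ofReal (J ω ^ p) ∂P := by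
    rw [← lintegral_rpow_eq_lintegral_meas_le_mul P
      (Eventually.of_forall fun ω => mul_nonneg ha0.le (hJ0 ω)) (hJm.const_mul a).aemeasurable hp,
      ← lintegral_const_mul' _ _ ENNReal.ofReal_ne_top]
    refine lintegral_congr fun ω => ?_
    rw [Real.mul_rpow ha0.le (hJ0 ω), ENNReal.ofReal_mul (by positivity)]
  have hB : ∫⁻ y in Ioi 0, (∫⁻ u in Ioi 0, P {ω | u < min (J ω) (y / a)}
        * ENNReal.ofReal (1 / (y + u))) * ENNReal.ofReal (y ^ (p - 1))
      = (∫⁻ s in Ioi a, ENNReal.ofReal (s ^ (p - 1) / (s + 1))) *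
        ∫⁻ u in Ioi 0, P {ω | u < J ω} * ENNReal.ofReal (u ^ (p - 1)) := by
    let F : ℝ → ℝ → ENNReal := fun y u => {q : ℝ × ℝ | a * q.2 < q.1}.indicator
      (fun q => P {ω | q.2 < J ω} * (ENNReal.ofReal (1 / (q.1 + q.2)) *
        ENNReal.ofReal (q.1 ^ (p - 1)))) (y, u)
    have hFm : Measurable (Function.uncurry F) := by
      refine Measurable.indicator ?_ (measurableSet_lt (by fun_prop) (by fun_prop))
      exact (hNm.comp measurable_snd).mul (by fun_prop)
    calc _ = ∫⁻ y in Ioi 0, ∫⁻ u in Ioi 0, F y u := by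
          refine setLIntegral_congr_fun measurableSet_Ioi fun y _ => ?_
          rw [← lintegral_mul_const' _ _ ENNReal.ofReal_ne_top]
          refine lintegral_congr fun u => ?_
          by_cases h : a * u < y
          · have : u < y / a := by rwa [lt_div_iff₀ ha0, mul_comm]
            simp [F, indicator, h, this, mul_assoc]
          · have : ¬ u < y / a := by rwa [lt_div_iff₀ ha0, mul_comm]
            simp [F, indicator, h, this]
      _ = ∫⁻ u in Ioi 0, ∫⁻ y in Ioi 0, F y u := lintegral_lintegral_swap hFm.aemeasurable
      _ = ∫⁻ u in Ioi 0, (∫⁻ s in Ioi a, ENNReal.ofReal (s ^ (p - 1) / (s + 1))) *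
            (P {ω | u < J ω} * ENNReal.ofReal (u ^ (p - 1))) := by
          refine setLIntegral_congr_fun measurableSet_Ioi fun u hu => ?_
          have hu0 : (0 : ℝ) < u := hu
          have e : ∀ y, F y u = (Ioi (a * u)).indicator (fun y => P {ω | u < J ω} *
              (ENNReal.ofReal (1 / (y + u)) * ENNReal.ofReal (y ^ (p - 1)))) y := fun y => rfl
          simp only [e]
          rw [setLIntegral_indicator measurableSet_Ioi,
            inter_eq_left.2 (Ioi_subset_Ioi (by positivity)),
            lintegral_const_mul' _ _ (measure_ne_top _ _), lintegral_rpow_div_add ha0 hu0]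
          ring
      _ = _ := lintegral_const_mul _ (hNm.mul hqm)
  rw [lintegral_rpow_eq_lintegral_meas_lt_mul P (Eventually.of_forall hM0) hMm.aemeasurable hp]
  calc _ ≤ ENNReal.ofReal p * ∫⁻ y in Ioi 0, (P {ω | y ≤ a * J ω} * ENNReal.ofReal (y ^ (p - 1))
        + (∫⁻ u in Ioi 0, P {ω | u < min (J ω) (y / a)} * ENNReal.ofReal (1 / (y + u)))
          * ENNReal.ofReal (y ^ (p - 1))) := by
        refine mul_le_mul' le_rfl (setLIntegral_mono' measurableSet_Ioi fun y hy => ?_)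
        rw [← add_mul]
        exact mul_le_mul' (hbound y hy) le_rfl
    _ = _ := by
        rw [lintegral_add_left hAq, mul_add, hA, hB, add_mul]
        congr 1
        rw [lintegral_rpow_eq_lintegral_meas_lt_mul P (Eventually.of_forall hJ0)
          hJm.aemeasurable hp]
        ring

lemma integrableOn_rpow_div_add_one {p a : ℝ} (hp1 : p < 1) (ha : 0 < a) :
    IntegrableOn (fun s : ℝ => s ^ (p - 1) / (s + 1)) (Ioi a) := by
  refine (integrableOn_Ioi_rpow_of_lt (by linarith : p - 2 < -1) ha).mono'
    (by fun_prop : Measurable _).aestronglyMeasurable ?_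
  filter_upwards [ae_restrict_mem measurableSet_Ioi] with s hs
  have hs0 : 0 < s := ha.trans hs
  rw [Real.norm_of_nonneg (by positivity), show p - 2 = (p - 1) - 1 by ring,
    Real.rpow_sub_one hs0.ne' (p - 1)]
  gcongr
  linarith

lemma integral_sup_rpow_le {Ω : Type*} {m0 : MeasurableSpace Ω} {P : Measure Ω}
    [IsProbabilityMeasure P] {ℱ : Filtration ℝ≥0 m0} {X : ℝ≥0 → Ω → ℝ}
    (hX : Supermartingale X ℱ P) (hX0 : ∀ ω, X 0 ω = 0) (hc : ∀ ω, IsCadlagUp fun s => X s ω)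
    (t : ℝ≥0) {p a : ℝ} (hp : 0 < p) (hp1 : p < 1) (ha : 1 ≤ a) :
    ∫ ω, (⨆ s : Icc (0 : ℝ≥0) t, |X s.1 ω|) ^ p ∂P
      ≤ (a ^ p + ∫ s in Ioi a, s ^ (p - 1) / (s + 1))
        * ∫ ω, (-(⨅ s : Icc (0 : ℝ≥0) t, min (X s.1 ω) 0)) ^ p ∂P := by
  have ha0 : 0 < a := by linarith
  have hXm : ∀ s, Measurable (X s) := fun s => (hX.1 s).measurable.mono (ℱ.le s) le_rfl
  have hMm : Measurable fun ω => ⨆ s : Icc (0 : ℝ≥0) t, |X s.1 ω| :=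
    measurable_iSup_Icc (h := fun s ω => |X s ω|)
      (fun s => continuous_abs.measurable.comp (hXm s))
      (fun ω => (hc ω).bddAbove t) fun ω s => (hc ω s).1.abs
  have hJm : Measurable fun ω => -(⨅ s : Icc (0 : ℝ≥0) t, min (X s.1 ω) 0) := by
    simp only [neg_iInf_eq_iSup]
    exact measurable_iSup_Icc (h := fun s ω => -min (X s ω) 0)
      (fun s => ((hXm s).min measurable_const).neg)
      (fun ω => (hc ω).bddAbove_neg_min t)
      fun ω s => ((hc ω s).1.min continuousWithinAt_const).neg
  have hM : ∀ ω y, y < (⨆ s : Icc (0 : ℝ≥0) t, |X s.1 ω|) ↔ ∃ s ≤ t, y < |X s ω| := fun ω y =>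
    lt_iSup_Icc_iff (h := fun s => |X s ω|) ((hc ω).bddAbove t)
  have hM0 : ∀ ω, 0 ≤ ⨆ s : Icc (0 : ℝ≥0) t, |X s.1 ω| := fun ω =>
    Real.iSup_nonneg fun s => abs_nonneg _
  have hJ0 : ∀ ω, 0 ≤ -(⨅ s : Icc (0 : ℝ≥0) t, min (X s.1 ω) 0) := fun ω =>
    neg_iInf_min_nonneg (fun s => X s ω) t
  have hJM : ∀ ω, -(⨅ s : Icc (0 : ℝ≥0) t, min (X s.1 ω) 0)
      ≤ ⨆ s : Icc (0 : ℝ≥0) t, |X s.1 ω| := by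
    intro ω
    by_contra! h
    obtain ⟨s, hst, hs⟩ := ((hc ω).lt_neg_iInf_iff (hM0 ω)).1 h
    exact lt_irrefl _ ((hM ω _).2 ⟨s, hst, hs.trans_le (neg_le_abs _)⟩)
  have hKi := integrableOn_rpow_div_add_one (p := p) hp1 ha0
  have hK0 : 0 ≤ᵐ[volume.restrict (Ioi a)] fun s : ℝ => s ^ (p - 1) / (s + 1) := by
    filter_upwards [ae_restrict_mem measurableSet_Ioi] with s hs
    have hs0 : 0 < s := ha0.trans hs
    simp only [Pi.zero_apply]
    positivity
  have hK : 0 ≤ ∫ s in Ioi a, s ^ (p - 1) / (s + 1) := integral_nonneg_of_ae hK0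
  have hle := lintegral_sup_rpow_le hX hX0 hc t hMm hM0 (fun ω y => (hM ω y).1) hJm
    (fun ω s hst => (hc ω).neg_le_neg_iInf hst) hp ha
  rw [← ofReal_integral_eq_lintegral_ofReal hKi hK0, ← ENNReal.ofReal_add (by positivity) hK] at hle
  have hMp : ∀ ω, 0 ≤ (⨆ s : Icc (0 : ℝ≥0) t, |X s.1 ω|) ^ p := fun ω =>
    Real.rpow_nonneg (hM0 ω) p
  have hJp : ∀ ω, 0 ≤ (-(⨅ s : Icc (0 : ℝ≥0) t, min (X s.1 ω) 0)) ^ p := fun ω =>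
    Real.rpow_nonneg (hJ0 ω) p
  by_cases hJi : Integrable (fun ω => (-(⨅ s : Icc (0 : ℝ≥0) t, min (X s.1 ω) 0)) ^ p) P
  · rw [← ofReal_integral_eq_lintegral_ofReal hJi (Eventually.of_forall hJp),
      ← ENNReal.ofReal_mul (by positivity)] at hle
    rw [integral_eq_lintegral_of_nonneg_ae (Eventually.of_forall hMp)
      (hMm.pow_const p).aestronglyMeasurable]
    exact ENNReal.toReal_le_of_le_ofReal
      (mul_nonneg (by positivity) (integral_nonneg hJp)) hle
  · have hMi : ¬ Integrable (fun ω => (⨆ s : Icc (0 : ℝ≥0) t, |X s.1 ω|) ^ p) P := fun h =>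
      hJi (h.mono' (hJm.pow_const p).aestronglyMeasurable (Eventually.of_forall fun ω => by
        rw [Real.norm_of_nonneg (hJp ω)]
        exact Real.rpow_le_rpow (hJ0 ω) (hJM ω) hp.le))
    rw [integral_undef hJi, integral_undef hMi, mul_zero]


/-- Sharp `L^p` bound for the two-sided maximal function of a supermartingale with
nonnegative jumps versus its running infimum: `E[(M_t)^p] ≤ 𝔠_p^p·E[(−M⁻_t)^p]` for
`0 < p < 1`, where `𝔠_p^p = (1/p − 1)^p + ∫_{1/p−1}^∞ s^(p−1)/(s+1) ds` if `p ≤ 1/2`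
and `𝔠_p^p = 1 + ∫_1^∞ s^(p−1)/(s+1) ds` if `p > 1/2`. -/
theorem supermartingale_Lp_maximal_bound
    {Ω : Type*} {m0 : MeasurableSpace Ω} {P : Measure Ω} [IsProbabilityMeasure P]
    (hcomplete : P.IsComplete)
    (ℱ : Filtration ℝ≥0 m0) (X : ℝ≥0 → Ω → ℝ)
    (hsuper : Supermartingale X ℱ P)
    (hX0 : ∀ᵐ ω ∂P, X 0 ω = 0)
    (hrc : ∀ ω, ∀ t : ℝ≥0, ContinuousWithinAt (fun s => X s ω) (Set.Ici t) t)
    (hll : ∀ ω, ∀ t : ℝ≥0, 0 < t →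
      ∃ l : ℝ, Tendsto (fun s => X s ω) (nhdsWithin t (Set.Iio t)) (nhds l))
    (hjump : ∀ ω, ∀ t : ℝ≥0, 0 < t → ∀ l : ℝ,
      Tendsto (fun s => X s ω) (nhdsWithin t (Set.Iio t)) (nhds l) → l ≤ X t ω)
    (p : ℝ) (hp : 0 < p) (hp1 : p < 1)
    (fcp : ℝ)
    (hfcp₁ : p ≤ 1 / 2 →
      fcp = (1 / p - 1) ^ p + ∫ s in Set.Ioi (1 / p - 1), s ^ (p - 1) / (s + 1))
    (hfcp₂ : 1 / 2 < p → fcp = 1 + ∫ s in Set.Ioi (1 : ℝ), s ^ (p - 1) / (s + 1))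
    (t : ℝ≥0) :
    ∫ ω, (⨆ s : Set.Icc (0 : ℝ≥0) t, |X s.1 ω|) ^ p ∂P
      ≤ fcp * ∫ ω, (-(⨅ s : Set.Icc (0 : ℝ≥0) t, min (X s.1 ω) 0)) ^ p ∂P := by
  let Z : ℝ≥0 → Ω → ℝ := fun s ω => X s ω - X 0 ω
  have hZ : Supermartingale Z ℱ P := by
    have h0 : Martingale (fun _ : ℝ≥0 => X 0) ℱ P :=
      ⟨fun s => (hsuper.1 0).mono (ℱ.mono zero_le), fun i j _ => by
        rw [condExp_of_stronglyMeasurable (ℱ.le i) ((hsuper.1 0).mono (ℱ.mono zero_le))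
          (hsuper.2.2 0)]⟩
    exact hsuper.sub_martingale h0
  have hc : ∀ ω, IsCadlagUp fun s => Z s ω := fun ω w =>
    ⟨(hrc ω w).sub continuousWithinAt_const, fun hw => by
      obtain ⟨l, hl⟩ := hll ω w hw
      exact ⟨l - X 0 ω, hl.sub_const _, sub_le_sub_right (hjump ω w hw l hl) _⟩⟩
  have key : ∀ a : ℝ, 1 ≤ a →
      ∫ ω, (⨆ s : Set.Icc (0 : ℝ≥0) t, |X s.1 ω|) ^ p ∂P
      ≤ (a ^ p + ∫ s in Ioi a, s ^ (p - 1) / (s + 1))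
        * ∫ ω, (-(⨅ s : Set.Icc (0 : ℝ≥0) t, min (X s.1 ω) 0)) ^ p ∂P := by
    intro a ha
    convert integral_sup_rpow_le hZ (fun ω => sub_self _) hc t hp hp1 ha using 1
    · refine integral_congr_ae ?_
      filter_upwards [hX0] with ω hω
      simp only [Z, hω, sub_zero]
    · congr 1
      refine integral_congr_ae ?_
      filter_upwards [hX0] with ω hω
      simp only [Z, hω, sub_zero]
  rcases le_or_gt p (1 / 2) with h | h
  · rw [hfcp₁ h]
    refine key _ ?_
    rw [le_sub_iff_add_le, le_div_iff₀ hp]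
    linarith
  · rw [hfcp₂ h]
    simpa using key 1 le_rfl
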